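/- Let X be a real Banach space, B a boundary for X, and (x_n) a bounded sequence in X. If the set A = {x_n : n ∈ ℕ} is relatively τ_B-compact (i.e. every pointwise-on-B cluster situation stays in X), then the operator S : ℓ¹ → X, S((λ_n)) = Σ λ_n x_n, is weakly compact. -/

import Mathlib

open Filter Topology Metric Bornology

noncomputable section

variable {X : Type*} [NormedAddCommGroup X] [NormedSpace ℝ X]

/-- Topology of pointwise convergence on a set `D` of functionals. -/
def ptwTop (D : Set (X →L[ℝ] ℝ)) : TopologicalSpace X :=
  TopologicalSpace.induced (fun x (d : D) => (d : X →L[ℝ] ℝ) x) Pi.topologicalSpace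

/-- Weak-star topology on the dual of `X`. -/
def wstarTop (X : Type*) [NormedAddCommGroup X] [NormedSpace ℝ X] :
    TopologicalSpace (X →L[ℝ] ℝ) :=
  TopologicalSpace.induced (fun f (x : X) => f x) Pi.topologicalSpace

/-- Weak-star closure of a set of functionals. -/
def wstarClosure (A : Set (X →L[ℝ] ℝ)) : Set (X →L[ℝ] ℝ) :=
  @closure _ (wstarTop X) A

/-- Weak topology on `X`. -/
def weakTop (X : Type*) [NormedAddCommGroup X] [NormedSpace ℝ X] :
    TopologicalSpace X :=
  TopologicalSpace.induced (fun x (f : X →L[ℝ] ℝ) => f x) Pi.topologicalSpace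

/-- `aco_∞(A)`: absolutely convex series combinations of elements of `A`. -/
def acoInf (A : Set X) : Set X :=
  {x | ∃ (α : ℕ → ℝ) (u : ℕ → X), (∀ n, u n ∈ A) ∧ Summable (fun n => |α n|) ∧
    (∑' n, |α n|) = 1 ∧ HasSum (fun n => α n • u n) x}

/-- absolutely convex hull -/
def aco (A : Set X) : Set X := convexHull ℝ (A ∪ -A)

/-- subspace topology -/
def subTop {α : Type*} (t : TopologicalSpace α) (s : Set α) : TopologicalSpace s :=
  TopologicalSpace.induced (Subtype.val : s → α) t

theorem exists_frequently_lt_of_attaining {E T : Type*} [NormedAddCommGroup E] [NormedSpace ℝ E]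
    [CompleteSpace E] (L : T → E →L[ℝ] ℝ) {M : ℝ} (hM : ∀ t, ‖L t‖ ≤ M)
    (hatt : ∀ u, ∃ t, ∀ t', L t' u ≤ L t u) (z : ℕ → E) {C : ℝ} (hC : ∀ n, ‖z n‖ ≤ C)
    {θ θ' : ℝ} (hθ : ∀ g ∈ convexHull ℝ (Set.range z), ∃ t, θ ≤ L t g) (hlt : θ' < θ) :
    ∃ t, ∃ᶠ i in atTop, θ' < L t (z i) := by
  choose τ hτ using hatt
  set p : E → ℝ := fun u => L (τ u) u with hp
  have hM0 : 0 ≤ M := (norm_nonneg _).trans (hM (τ 0))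
  have hLle : ∀ t u, |L t u| ≤ M * ‖u‖ := fun t u =>
    ((L t).le_opNorm u).trans (mul_le_mul_of_nonneg_right (hM t) (norm_nonneg _))
  set K : ℕ → Set E := fun n => convexHull ℝ (z '' Set.Ici n) with hK
  have hKconv : ∀ n, Convex ℝ (K n) := fun n => convex_convexHull ℝ _
  have hKanti : ∀ m n, m ≤ n → K n ⊆ K m := fun m n h =>
    convexHull_mono (Set.image_mono (Set.Ici_subset_Ici.2 h))
  have hKz : ∀ n, z n ∈ K n := fun n => subset_convexHull ℝ _ ⟨n, Set.mem_Ici.2 le_rfl, rfl⟩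
  have hKC : ∀ n, ∀ h ∈ K n, ‖h‖ ≤ C := by
    intro n h hh
    have : K n ⊆ closedBall 0 C := convexHull_min (by
      rintro _ ⟨i, -, rfl⟩; simpa using hC i) (convex_closedBall 0 C)
    simpa using this hh
  have hC0 : 0 ≤ C := (norm_nonneg _).trans (hC 0)
  set η : ℝ := (θ - θ') / 2 with hη
  have hη0 : 0 < η := by rw [hη]; linarith
  have hstep : ∀ (n : ℕ) (u : E), ∃ g ∈ K n, ∀ h ∈ K n,
      p (u + (1/2:ℝ)^n • g) ≤ p (u + (1/2:ℝ)^n • h) + (1/2:ℝ)^(n+1) * η * (1/2:ℝ)^(n+1) := by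
    intro n u
    set s : Set ℝ := (fun h => p (u + (1/2:ℝ)^n • h)) '' K n with hs
    have hne : s.Nonempty := ⟨_, z n, hKz n, rfl⟩
    have hbd : BddBelow s := by
      refine ⟨-(M * (‖u‖ + (1/2:ℝ)^n * C)), ?_⟩
      rintro _ ⟨h, hh, rfl⟩
      have h1 := neg_le_of_abs_le (hLle (τ (u + (1/2:ℝ)^n • h)) (u + (1/2:ℝ)^n • h))
      refine le_trans (neg_le_neg (mul_le_mul_of_nonneg_left ?_ hM0)) h1
      refine (norm_add_le _ _).trans (add_le_add le_rfl ?_)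
      rw [norm_smul, Real.norm_of_nonneg (by positivity)]
      exact mul_le_mul_of_nonneg_left (hKC n h hh) (by positivity)
    obtain ⟨_, ⟨g, hg, rfl⟩, hlt⟩ := exists_lt_of_csInf_lt hne
      (lt_add_of_pos_right (sInf s) (show 0 < (1/2:ℝ)^(n+1) * η * (1/2:ℝ)^(n+1) by positivity))
    refine ⟨g, hg, fun h hh => hlt.le.trans ?_⟩
    gcongr
    exact csInf_le hbd ⟨h, hh, rfl⟩
  choose G hGK hG using hstep
  set u : ℕ → E := fun n => Nat.rec 0 (fun n v => v + (1/2:ℝ)^(n+1) • G n v) n with hu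
  have hu0 : u 0 = 0 := rfl
  have husucc : ∀ n, u (n+1) = u n + (1/2:ℝ)^(n+1) • G n (u n) := fun n => rfl
  have hmid : ∀ n, ∀ h ∈ K (n+1), ∃ h' ∈ K n,
      u (n+1) + (1/2:ℝ)^(n+1) • h = u n + (1/2:ℝ)^n • h' := by
    intro n h hh
    refine ⟨(1/2:ℝ) • G n (u n) + (1/2:ℝ) • h, hKconv n (hGK n _) (hKanti n (n+1) (by simp) hh)
      (by norm_num) (by norm_num) (by norm_num), ?_⟩
    rw [husucc]
    simp only [pow_succ]
    module
  have hp0 : p 0 = 0 := by simp [hp]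
  have hinv : ∀ n, ∀ h ∈ K n, p (u n) + (θ - η * (1 - (1/2:ℝ)^n)) * (1/2:ℝ)^n
      ≤ p (u n + (1/2:ℝ)^n • h) := by
    intro n
    induction n with
    | zero =>
      intro h hh
      obtain ⟨t, ht⟩ := hθ h (convexHull_mono (Set.image_subset_range _ _) hh)
      simp only [hu0, hp0, pow_zero, one_smul, zero_add]
      have := hτ h t
      simp only [hp]; linarith
    | succ n ih =>
      intro h hh
      obtain ⟨h', hh', heq⟩ := hmid n h hh
      rw [heq]
      have h1 := hG n (u n) h' hh'
      have h2 := ih _ (hGK n (u n))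
      have h3 : p (u (n+1)) ≤ (1/2) * p (u n) + (1/2) * p (u n + (1/2:ℝ)^n • G n (u n)) := by
        have h4 : u (n+1) = (1/2:ℝ) • u n + (1/2:ℝ) • (u n + (1/2:ℝ)^n • G n (u n)) := by
          rw [husucc, pow_succ]; module
        have h5 : p (u (n+1)) = (1/2) * L (τ (u (n+1))) (u n)
            + (1/2) * L (τ (u (n+1))) (u n + (1/2:ℝ)^n • G n (u n)) := by
          simp only [hp]
          conv_lhs => rw [h4]
          rw [map_add, map_smul, map_smul, smul_eq_mul, smul_eq_mul, ← h4]
        rw [h5]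
        have := hτ (u n) (τ (u (n+1)))
        have := hτ (u n + (1/2:ℝ)^n • G n (u n)) (τ (u (n+1)))
        simp only [hp]; linarith
      have h6 : (1/2:ℝ)^n = 2 * (1/2:ℝ)^(n+1) := by rw [pow_succ]; ring
      rw [h6] at h1 h2 h3
      rw [h6]
      nlinarith
  have hmid' : ∀ n m, n ≤ m → ∀ h ∈ K m, ∃ h' ∈ K n,
      u m + (1/2:ℝ)^m • h = u n + (1/2:ℝ)^n • h' := by
    intro n m hnm
    induction m, hnm using Nat.le_induction with
    | base => exact fun h hh => ⟨h, hh, rfl⟩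
    | succ m _ ih =>
      intro h hh
      obtain ⟨h1, hh1, e1⟩ := hmid m h hh
      obtain ⟨h2, hh2, e2⟩ := ih h1 hh1
      exact ⟨h2, hh2, e1.trans e2⟩
  have hcau : CauchySeq u := by
    refine cauchySeq_of_le_geometric_two (C := C) fun n => ?_
    rw [husucc, dist_self_add_right, norm_smul, Real.norm_of_nonneg (by positivity)]
    have := hKC n _ (hGK n (u n))
    rw [one_div, inv_pow, pow_succ, mul_inv, div_div, div_eq_mul_inv, mul_inv, mul_comm C,
      mul_comm (2⁻¹:ℝ)]
    exact mul_le_mul_of_nonneg_left this (by positivity)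
  obtain ⟨w, hw⟩ := cauchySeq_tendsto_of_complete hcau
  have hpow : Tendsto (fun m : ℕ => (1/2:ℝ)^m) atTop (𝓝 0) :=
    tendsto_pow_atTop_nhds_zero_of_lt_one (by norm_num) (by norm_num)
  have hv : Tendsto (fun m => ‖u m + (1/2:ℝ)^m • z m - w‖) atTop (𝓝 0) := by
    have h1 : Tendsto (fun m => ‖u m - w‖ + (1/2:ℝ)^m * C) atTop (𝓝 0) := by
      simpa using (tendsto_iff_norm_sub_tendsto_zero.1 hw).add (hpow.mul_const C)
    refine squeeze_zero (fun _ => norm_nonneg _) (fun m => ?_) h1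
    rw [add_sub_right_comm]
    refine (norm_add_le _ _).trans (add_le_add le_rfl ?_)
    rw [norm_smul, Real.norm_of_nonneg (by positivity)]
    exact mul_le_mul_of_nonneg_left (hC m) (by positivity)
  have hlow : ∀ n, p (u n) + (θ - η * (1 - (1/2:ℝ)^n)) * (1/2:ℝ)^n ≤ p w := by
    intro n
    have h1 : Tendsto (fun m => p w + M * ‖u m + (1/2:ℝ)^m • z m - w‖) atTop (𝓝 (p w)) := by
      simpa using (hv.const_mul M).const_add (p w)
    refine ge_of_tendsto h1 ?_
    filter_upwards [eventually_ge_atTop n] with m hm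
    obtain ⟨h', hh', e⟩ := hmid' n m hm (z m) (hKz m)
    refine (hinv n h' hh').trans ?_
    rw [e]
    set v := u n + (1/2:ℝ)^n • h'
    have h2 := le_of_abs_le (hLle (τ v) (v - w))
    have h3 := hτ w (τ v)
    rw [map_sub] at h2
    simp only [hp]; linarith
  refine ⟨τ w, fun hnot => ?_⟩
  obtain ⟨n, hn⟩ := eventually_atTop.1 hnot
  have hKn : ∀ k ≥ n, ∀ g ∈ K k, L (τ w) g ≤ θ' := by
    intro k hk g hg
    have : K k ⊆ {g | L (τ w) g ≤ θ'} := convexHull_min (by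
      rintro _ ⟨i, hi, rfl⟩
      exact not_lt.1 (hn i (hk.trans hi))) (convex_halfSpace_le (L (τ w)).isLinear θ')
    exact this hg
  have hup : ∀ m ≥ n, L (τ w) (u m) ≤ L (τ w) (u n) + θ' * ((1/2:ℝ)^n - (1/2:ℝ)^m) := by
    intro m hm
    induction m, hm using Nat.le_induction with
    | base => simp
    | succ m hm ih =>
      have h1 := mul_le_mul_of_nonneg_left (hKn m hm _ (hGK m (u m)))
        (show (0:ℝ) ≤ (1/2:ℝ)^(m+1) by positivity)
      rw [husucc, map_add, map_smul, smul_eq_mul]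
      have h6 : (1/2:ℝ)^m = 2 * (1/2:ℝ)^(m+1) := by rw [pow_succ]; ring
      rw [h6] at ih
      linarith
  have hlim : L (τ w) w ≤ L (τ w) (u n) + θ' * (1/2:ℝ)^n := by
    have h1 : Tendsto (fun m => L (τ w) (u n) + θ' * ((1/2:ℝ)^n - (1/2:ℝ)^m)) atTop
        (𝓝 (L (τ w) (u n) + θ' * (1/2:ℝ)^n)) := by
      simpa using ((hpow.const_sub ((1/2:ℝ)^n)).const_mul θ').const_add (L (τ w) (u n))
    exact le_of_tendsto_of_tendsto (((L (τ w)).continuous.tendsto w).comp hw) h1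
      (eventually_atTop.2 ⟨n, hup⟩)
  have h1 := hlow n
  have h2 := hτ (u n) (τ w)
  have h3 : (0:ℝ) < (1/2:ℝ)^n := by positivity
  have h4 : θ' < θ - η * (1 - (1/2:ℝ)^n) := by
    have : 0 < η * (1/2:ℝ)^n := by positivity
    have : θ - θ' = 2 * η := by rw [hη]; ring
    linarith
  simp only [hp] at h1
  have := mul_lt_mul_of_pos_right h4 h3
  linarith

theorem exists_infinite_almost_subset {N : ℕ → Set ℕ} (hanti : Antitone N)
    (hinf : ∀ n, (N n).Infinite) :
    ∃ P : Set ℕ, P ⊆ N 0 ∧ P.Infinite ∧ ∀ n, (P \ N n).Finite := by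
  obtain ⟨φ, hφ, hN⟩ := extraction_forall_of_frequently
    (fun n => Nat.frequently_atTop_iff_infinite.2 (hinf n))
  refine ⟨Set.range φ, ?_, Set.infinite_range_of_injective hφ.injective, fun n => ?_⟩
  · rintro _ ⟨i, rfl⟩
    exact hanti (Nat.zero_le i) (hN i)
  · refine ((Set.finite_Iio n).image φ).subset ?_
    rintro _ ⟨⟨i, rfl⟩, hi⟩
    refine ⟨i, ?_, rfl⟩
    by_contra h
    exact hi (hanti (not_lt.1 h) (hN i))

theorem exists_infinite_deciding {ι : Type*} [Countable ι] [Nonempty ι] {p : ι → Set ℕ → Prop}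
    (hp : ∀ i N N', N'.Infinite → (N' \ N).Finite → p i N → p i N')
    {M : Set ℕ} (hM : M.Infinite) :
    ∃ N ⊆ M, N.Infinite ∧ ∀ i, p i N ∨ ∀ N' ⊆ N, N'.Infinite → ¬ p i N' := by
  obtain ⟨e, he⟩ := exists_surjective_nat ι
  have hstep : ∀ (i : ι) (N : {N : Set ℕ // N.Infinite}), ∃ N' : {N : Set ℕ // N.Infinite},
      N'.1 ⊆ N.1 ∧ (p i N' ∨ ∀ N'' ⊆ N'.1, N''.Infinite → ¬ p i N'') := by
    rintro i ⟨N, hN⟩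
    by_cases h : ∃ N' ⊆ N, N'.Infinite ∧ p i N'
    · obtain ⟨N', h1, h2, h3⟩ := h
      exact ⟨⟨N', h2⟩, h1, Or.inl h3⟩
    · push Not at h
      exact ⟨⟨N, hN⟩, subset_rfl, Or.inr h⟩
  choose f hf hf' using hstep
  set u : ℕ → {N : Set ℕ // N.Infinite} := fun n => Nat.rec ⟨M, hM⟩ (fun n v => f (e n) v) n
    with hu
  have hus : ∀ n, u (n+1) = f (e n) (u n) := fun n => rfl
  have hanti : Antitone (fun n => (u n).1) := antitone_nat_of_succ_le fun n => by
    rw [hus]; exact hf _ _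
  obtain ⟨P, hP0, hPinf, hP⟩ := exists_infinite_almost_subset hanti (fun n => (u n).2)
  refine ⟨P, hP0, hPinf, fun i => ?_⟩
  obtain ⟨n, rfl⟩ := he i
  have h1 := hf' (e n) (u n)
  rw [← hus] at h1
  refine h1.imp (hp _ _ _ hPinf (hP (n+1))) fun h N' hN' hinf hpN' => ?_
  have h2 : (N' \ (u (n+1)).1).Finite := (hP (n+1)).subset (Set.sdiff_subset_sdiff_left hN')
  have h3 : (N' ∩ (u (n+1)).1).Infinite := by
    intro hfin
    apply hinf
    rw [← Set.inter_union_sdiff N' (u (n+1)).1]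
    exact hfin.union h2
  exact h _ Set.inter_subset_right h3
    (hp _ _ _ h3 (by simp [Set.sdiff_eq_empty.2 Set.inter_subset_left]) hpN')

/-- Some functional in `B` is above `c + q` on `F` and at infinitely many indices of `N`, and
below `c` on `G` and at infinitely many indices of `N`. -/
def Oscillates {X : Type*} [NormedAddCommGroup X] [NormedSpace ℝ X] (B : Set (X →L[ℝ] ℝ))
    (x : ℕ → X) (F G : Finset ℕ) (q : ℝ) (N : Set ℕ) : Prop :=
  ∃ b ∈ B, ∃ c : ℝ, (∀ k ∈ F, c + q < b (x k)) ∧ (∀ k ∈ G, b (x k) < c) ∧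
    {n ∈ N | c + q < b (x n)}.Infinite ∧ {n ∈ N | b (x n) < c}.Infinite

section

variable {X : Type*} [NormedAddCommGroup X] [NormedSpace ℝ X] {B : Set (X →L[ℝ] ℝ)} {x : ℕ → X}
  {F G : Finset ℕ} {q : ℝ} {N : Set ℕ}

theorem Oscillates.mono {q' : ℝ} (h : Oscillates B x F G q N) (hq : q' ≤ q) :
    Oscillates B x F G q' N := by
  obtain ⟨b, hb, c, h1, h2, h3, h4⟩ := h
  exact ⟨b, hb, c, fun k hk => lt_of_le_of_lt (by linarith) (h1 k hk), h2,
    h3.mono fun n hn => ⟨hn.1, lt_of_le_of_lt (by linarith) hn.2⟩, h4⟩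

theorem Oscillates.of_almost_subset {N' : Set ℕ} (h : Oscillates B x F G q N')
    (hN : (N' \ N).Finite) : Oscillates B x F G q N := by
  obtain ⟨b, hb, c, h1, h2, h3, h4⟩ := h
  have key : ∀ P : ℕ → Prop, {n ∈ N' | P n}.Infinite → {n ∈ N | P n}.Infinite := by
    intro P hP hfin
    refine hP ((hfin.union hN).subset ?_)
    intro n hn
    by_cases h : n ∈ N
    · exact Or.inl ⟨h, hn.2⟩
    · exact Or.inr ⟨hn.1, h⟩
  exact ⟨b, hb, c, h1, h2, key _ h3, key _ h4⟩

theorem Oscillates.le_two_mul {C : ℝ} (hB : B ⊆ closedBall 0 1) (hC : ∀ n, ‖x n‖ ≤ C)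
    (h : Oscillates B x F G q N) : q ≤ 2 * C := by
  obtain ⟨b, hb, c, -, -, h3, h4⟩ := h
  obtain ⟨n, -, hn⟩ := h3.nonempty
  obtain ⟨m, -, hm⟩ := h4.nonempty
  have hb1 : ‖b‖ ≤ 1 := by simpa using hB hb
  have key : ∀ n, |b (x n)| ≤ C := fun n => by
    have := b.le_of_opNorm_le hb1 (x n)
    rw [one_mul, Real.norm_eq_abs] at this
    exact this.trans (hC n)
  have := le_of_abs_le (key n)
  have := neg_le_of_abs_le (key m)
  linarith

theorem Oscillates.finite_left (h : ∀ N' ⊆ N, N'.Infinite → Oscillates B x F G q N') :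
    {k ∈ N | ¬ Oscillates B x (insert k F) G q N}.Finite := by
  by_contra hinf
  obtain ⟨b, hb, c, h1, h2, h3, h4⟩ := h _ (Set.sep_subset _ _) hinf
  obtain ⟨k, hk, hk'⟩ := h3.nonempty
  refine hk.2 ⟨b, hb, c, ?_, h2, h3.mono fun n hn => ⟨hn.1.1, hn.2⟩,
    h4.mono fun n hn => ⟨hn.1.1, hn.2⟩⟩
  intro n hn
  rcases Finset.mem_insert.1 hn with rfl | hn
  exacts [hk', h1 n hn]

theorem Oscillates.finite_right (h : ∀ N' ⊆ N, N'.Infinite → Oscillates B x F G q N') :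
    {k ∈ N | ¬ Oscillates B x F (insert k G) q N}.Finite := by
  by_contra hinf
  obtain ⟨b, hb, c, h1, h2, h3, h4⟩ := h _ (Set.sep_subset _ _) hinf
  obtain ⟨k, hk, hk'⟩ := h4.nonempty
  refine hk.2 ⟨b, hb, c, h1, ?_, h3.mono fun n hn => ⟨hn.1.1, hn.2⟩,
    h4.mono fun n hn => ⟨hn.1.1, hn.2⟩⟩
  intro n hn
  rcases Finset.mem_insert.1 hn with rfl | hn
  exacts [hk', h2 n hn]

theorem exists_strictMono_independent {C : ℝ} (hB : B ⊆ closedBall 0 1) (hC : ∀ n, ‖x n‖ ≤ C)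
    (hosc : ∀ N : Set ℕ, N.Infinite → ∃ q > 0, Oscillates B x ∅ ∅ q N) :
    ∃ φ : ℕ → ℕ, StrictMono φ ∧ ∃ δ > 0,
      (∀ r < δ, ∃ m, ∀ F G : Finset ℕ, Disjoint F G → (∀ i ∈ F, m ≤ i) → (∀ i ∈ G, m ≤ i) →
        ∃ b ∈ B, ∃ c : ℝ, (∀ i ∈ F, c + r < b (x (φ i))) ∧ ∀ i ∈ G, b (x (φ i)) < c) ∧
      ∀ q > δ, ∀ b ∈ B, ∀ c : ℝ, {n | c + q < b (x (φ n))}.Infinite →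
        ¬ {n | b (x (φ n)) < c}.Infinite := by
  obtain ⟨N, -, hN, hdec⟩ := exists_infinite_deciding (ι := Finset ℕ × Finset ℕ × ℚ)
    (p := fun i N => ¬ Oscillates B x i.1 i.2.1 i.2.2 N)
    (fun i N N' _ hfin h h' => h (h'.of_almost_subset hfin)) Set.infinite_univ
  have hdec' : ∀ (F G : Finset ℕ) (q : ℚ), Oscillates B x F G q N →
      ∀ N' ⊆ N, N'.Infinite → Oscillates B x F G q N' := fun F G q h N' h1 h2 =>
    not_not.1 (((hdec (F, G, q)).resolve_left (not_not.2 h)) N' h1 h2)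
  set s : Set ℝ := {r | Oscillates B x ∅ ∅ r N} with hs
  have hsb : BddAbove s := ⟨2 * C, fun r hr => Oscillates.le_two_mul hB hC hr⟩
  obtain ⟨q₀, hq₀, hq₀'⟩ := hosc N hN
  have hδ : 0 < sSup s := hq₀.trans_le (le_csSup hsb hq₀')
  have hq : ∀ j : ℕ, ∃ q : ℚ, sSup s - 1 / ((j:ℝ) + 1) < q ∧ Oscillates B x ∅ ∅ q N := by
    intro j
    obtain ⟨r, hr, hlt⟩ := exists_lt_of_lt_csSup ⟨q₀, hq₀'⟩
      (show sSup s - 1 / ((j:ℝ) + 1) < sSup s from sub_lt_self _ Nat.one_div_pos_of_nat)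
    obtain ⟨q, h1, h2⟩ := exists_rat_btwn hlt
    exact ⟨q, h1, Oscillates.mono hr h2.le⟩
  choose q hq hq' using hq
  set bad : ℕ → Set ℕ := fun M => ⋃ F ∈ (Finset.range M).powerset,
    ⋃ G ∈ (Finset.range M).powerset, ⋃ j ∈ Finset.range M,
      {k ∈ N | Oscillates B x F G (q j) N ∧ (¬ Oscillates B x (insert k F) G (q j) N ∨
        ¬ Oscillates B x F (insert k G) (q j) N)} with hbad
  have hbadfin : ∀ M, (bad M).Finite := by
    intro M
    refine Set.Finite.biUnion (Finset.finite_toSet _) fun F _ =>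
      Set.Finite.biUnion (Finset.finite_toSet _) fun G _ =>
      Set.Finite.biUnion (Finset.finite_toSet _) fun j _ => ?_
    by_cases h : Oscillates B x F G (q j) N
    · refine ((Oscillates.finite_left (hdec' _ _ _ h)).union
        (Oscillates.finite_right (hdec' _ _ _ h))).subset ?_
      rintro k ⟨hk, -, h1 | h1⟩
      exacts [Or.inl ⟨hk, h1⟩, Or.inr ⟨hk, h1⟩]
    · refine Set.finite_empty.subset ?_
      rintro k ⟨-, h1, -⟩
      exact h h1
  have hnext : ∀ M, ∃ k ∈ N, M ≤ k ∧ k ∉ bad M := by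
    intro M
    have h1 : (N \ (bad M ∪ Set.Iio M)).Infinite :=
      hN.sdiff ((hbadfin M).union (Set.finite_Iio M))
    obtain ⟨k, hk, hk'⟩ := h1.nonempty
    simp only [Set.mem_union, Set.mem_Iio, not_or, not_lt] at hk'
    exact ⟨k, hk, hk'.2, hk'.1⟩
  choose f hfN hfle hfbad using hnext
  set φ : ℕ → ℕ := fun n => Nat.rec (f 0) (fun _ v => f (v + 1)) n with hφ
  have hφs : ∀ n, φ (n+1) = f (φ n + 1) := fun n => rfl
  have hmono : StrictMono φ := strictMono_nat_of_lt_succ fun n => by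
    rw [hφs]; exact hfle _
  have hφN : ∀ n, φ n ∈ N := by
    rintro (_ | n)
    exacts [hfN 0, hfN _]
  have hind : ∀ j n : ℕ, ∀ F G : Finset ℕ, Disjoint F G → F ⊆ Finset.range n →
      G ⊆ Finset.range n → (∀ i ∈ F, j < i) → (∀ i ∈ G, j < i) →
      Oscillates B x (F.image φ) (G.image φ) (q j) N := by
    intro j n
    induction n with
    | zero =>
      intro F G _ hF hG _ _
      rw [Finset.range_zero, Finset.subset_empty] at hF hG
      subst hF hG
      simpa using hq' j
    | succ n ih =>
      intro F G hd hF hG hjF hjG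
      have hsub : ∀ F : Finset ℕ, F ⊆ Finset.range (n+1) → F.erase n ⊆ Finset.range n := by
        intro F hF i hi
        have h1 := Finset.mem_range.1 (hF (Finset.mem_of_mem_erase hi))
        have h2 := Finset.ne_of_mem_erase hi
        exact Finset.mem_range.2 (by omega)
      have himg : ∀ F : Finset ℕ, 1 ≤ n → F ⊆ Finset.range n →
          F.image φ ∈ (Finset.range (φ (n-1) + 1)).powerset := by
        intro F hn hF
        rw [Finset.mem_powerset, Finset.image_subset_iff]
        intro i hi
        have h1 := Finset.mem_range.1 (hF hi)
        exact Finset.mem_range.2 (Nat.lt_succ_of_le (hmono.monotone (by omega)))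
      have hmain : ∀ F G : Finset ℕ, F ⊆ Finset.range n → G ⊆ Finset.range n → j < n →
          Oscillates B x (F.image φ) (G.image φ) (q j) N →
          Oscillates B x (insert (φ n) (F.image φ)) (G.image φ) (q j) N ∧
          Oscillates B x (F.image φ) (insert (φ n) (G.image φ)) (q j) N := by
        intro F G hF hG hj ho
        have h1 : φ n = f (φ (n-1) + 1) := by rw [← hφs, Nat.sub_add_cancel (by omega)]
        have h2 := hfbad (φ (n-1) + 1)
        rw [← h1] at h2
        by_contra hcon
        apply h2
        rw [hbad]
        refine Set.mem_biUnion (himg F (by omega) hF) (Set.mem_biUnion (himg G (by omega) hG)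
          (Set.mem_biUnion (x := j) ?_ ⟨hφN n, ho, not_and_or.1 hcon⟩))
        have := hmono.le_apply (x := n - 1)
        exact Finset.mem_coe.2 (Finset.mem_range.2 (by omega))
      have hmem : ∀ F : Finset ℕ, n ∉ F → F ⊆ Finset.range (n+1) → F ⊆ Finset.range n := by
        intro F hn hF
        have := hsub F hF
        rwa [Finset.erase_eq_of_notMem hn] at this
      by_cases hnF : n ∈ F
      · have hnG : n ∉ G := Finset.disjoint_left.1 hd hnF
        have h1 := ih (F.erase n) G (hd.mono_left (Finset.erase_subset _ _)) (hsub F hF)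
          (hmem G hnG hG) (fun i hi => hjF i (Finset.mem_of_mem_erase hi)) hjG
        have h2 := (hmain _ _ (hsub F hF) (hmem G hnG hG) (hjF n hnF) h1).1
        rwa [← Finset.image_insert, Finset.insert_erase hnF] at h2
      · by_cases hnG : n ∈ G
        · have h1 := ih F (G.erase n) (hd.mono_right (Finset.erase_subset _ _)) (hmem F hnF hF)
            (hsub G hG) hjF (fun i hi => hjG i (Finset.mem_of_mem_erase hi))
          have h2 := (hmain _ _ (hmem F hnF hF) (hsub G hG) (hjG n hnG) h1).2
          rwa [← Finset.image_insert, Finset.insert_erase hnG] at h2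
        · exact ih F G hd (hmem F hnF hF) (hmem G hnG hG) hjF hjG
  refine ⟨φ, hmono, sSup s, hδ, fun r hr => ?_, fun t ht b hb c h1 h2 => ?_⟩
  · obtain ⟨j, hj⟩ := exists_nat_one_div_lt (sub_pos.2 hr)
    refine ⟨j + 1, fun F G hd hF hG => ?_⟩
    obtain ⟨n, hn⟩ : ∃ n, F ∪ G ⊆ Finset.range n := Finset.exists_nat_subset_range _
    obtain ⟨b, hb, c, h1, h2, -, -⟩ := hind j n F G hd (Finset.union_subset_left hn)
      (Finset.union_subset_right hn) hF hG
    refine ⟨b, hb, c, fun i hi => ?_, fun i hi => h2 _ (Finset.mem_image_of_mem _ hi)⟩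
    have h3 := h1 _ (Finset.mem_image_of_mem φ hi)
    have h4 := hq j
    linarith
  · have key : ∀ P : ℕ → Prop, {n | P (φ n)}.Infinite → {n ∈ N | P n}.Infinite := by
      intro P hP
      refine (hP.image hmono.injective.injOn).mono ?_
      rintro _ ⟨n, hn, rfl⟩
      exact ⟨hφN n, hn⟩
    have h3 : t ∈ s := ⟨b, hb, c, by simp, by simp, key _ h1, key _ h2⟩
    exact absurd (le_csSup hsb h3) (not_le.2 ht)

end

theorem neBot_atTop_inf_principal {A : Set ℕ} (hA : A.Infinite) :
    (atTop ⊓ 𝓟 A : Filter ℕ).NeBot :=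
  frequently_mem_iff_neBot.1 (Nat.frequently_atTop_iff_infinite.2 hA)

theorem atTop_inf_principal_mono {A A' : Set ℕ} (h : (A \ A').Finite) :
    (atTop ⊓ 𝓟 A : Filter ℕ) ≤ atTop ⊓ 𝓟 A' := by
  refine le_inf inf_le_left (le_principal_iff.2 ?_)
  rw [← Nat.cofinite_eq_atTop, mem_inf_principal]
  refine h.subset fun n hn => ?_
  simpa using hn

theorem tendsto_atTop_inf_principal_range {φ : ℕ → ℕ} (hφ : φ.Injective) {α : Type*} {u : ℕ → α}
    {f : Filter α} (h : Tendsto (fun n => u (φ n)) atTop f) :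
    Tendsto u (atTop ⊓ 𝓟 (Set.range φ)) f := by
  rw [← Nat.cofinite_eq_atTop, ← map_comap, hφ.comap_cofinite_eq, Nat.cofinite_eq_atTop]
  exact tendsto_map'_iff.2 h

section

variable {X : Type*} [NormedAddCommGroup X] [NormedSpace ℝ X] {B : Set (X →L[ℝ] ℝ)} {x : ℕ → X}

theorem abs_apply_le_norm (hB : B ⊆ closedBall 0 1) {b : X →L[ℝ] ℝ} (hb : b ∈ B) (v : X) :
    |b v| ≤ ‖v‖ := by
  have hb1 : ‖b‖ ≤ 1 := by simpa using hB hb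
  simpa using b.le_of_opNorm_le hb1 v

theorem exists_forall_apply_le (hB : B ⊆ closedBall 0 1) (hbd : ∀ v : X, ∃ b ∈ B, b v = ‖v‖)
    (v : X) : ∃ b : B, ∀ b' : B, b'.1 v ≤ b.1 v := by
  obtain ⟨b, hb, h⟩ := hbd v
  exact ⟨⟨b, hb⟩, fun b' => h ▸ le_of_abs_le (abs_apply_le_norm hB b'.2 v)⟩

theorem sub_le_of_tendsto_of_not_oscillating {b : X →L[ℝ] ℝ} {δ : ℝ}
    (hosc : ∀ q > δ, ∀ c : ℝ, {n | c + q < b (x n)}.Infinite → ¬ {n | b (x n) < c}.Infinite)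
    {f g : Filter ℕ} [f.NeBot] [g.NeBot] (hf : f ≤ atTop) (hg : g ≤ atTop) {l l' : ℝ}
    (h : Tendsto (fun n => b (x n)) f (𝓝 l)) (h' : Tendsto (fun n => b (x n)) g (𝓝 l')) :
    l - l' ≤ δ := by
  by_contra! hlt
  obtain ⟨q, hq, hq'⟩ := exists_between hlt
  obtain ⟨c, hc, hc'⟩ := exists_between (show l' < l - q by linarith)
  refine hosc q hq c (Nat.frequently_atTop_iff_infinite.1 (Frequently.filter_mono ?_ hf))
    (Nat.frequently_atTop_iff_infinite.1 (Frequently.filter_mono ?_ hg))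
  · exact (h.eventually_const_lt (by linarith)).frequently
  · exact (h'.eventually_lt_const hc).frequently

theorem exists_functional_separating_limits [CompleteSpace X] (hB : B ⊆ closedBall 0 1)
    (hbd : ∀ v : X, ∃ b ∈ B, b v = ‖v‖) {C : ℝ} (hC : ∀ n, ‖x n‖ ≤ C) {δ : ℝ}
    (hind : ∀ r < δ, ∃ m, ∀ F G : Finset ℕ, Disjoint F G → (∀ i ∈ F, m ≤ i) → (∀ i ∈ G, m ≤ i) →
        ∃ b ∈ B, ∃ c : ℝ, (∀ i ∈ F, c + r < b (x i)) ∧ ∀ i ∈ G, b (x i) < c)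
    (hosc : ∀ b ∈ B, ∀ q > δ, ∀ c : ℝ, {n | c + q < b (x n)}.Infinite →
        ¬ {n | b (x n) < c}.Infinite)
    {A : ℕ → Set ℕ} (hA : ∀ j, (A j).Infinite) (s : ℕ) {ε : ℝ} (hε : 0 < ε) :
    ∃ b ∈ B, ∃ (l : ℕ → ℝ) (A' : ℕ → Set ℕ), (∀ j, A' j ⊆ A j) ∧ (∀ j, (A' j).Infinite) ∧
      (∀ j, Tendsto (fun n => b (x n)) (atTop ⊓ 𝓟 (A' j)) (𝓝 (l j))) ∧
      ∀ j ≤ s, δ - ε ≤ l j - l (s + 1) := by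
  obtain ⟨k, hk, hkA⟩ := extraction_forall_of_frequently
    (P := fun t n => n ∈ A t.unpair.2) (fun t => Nat.frequently_atTop_iff_infinite.2 (hA t.unpair.2))
  set e : ℕ → ℕ → ℕ := fun i j => k (Nat.pair i j) with he
  have heA : ∀ i j, e i j ∈ A j := fun i j => by simpa using hkA (Nat.pair i j)
  have hele : ∀ i j, i ≤ e i j := fun i j => (Nat.left_le_pair i j).trans hk.le_apply
  have heinj : ∀ i j i' j', e i j = e i' j' → i = i' ∧ j = j' := fun i j i' j' h =>
    Nat.pair_eq_pair.1 (hk.injective h)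
  have hs0 : (0:ℝ) < s + 1 := by positivity
  set r : ℝ := δ - ε / (2 * (s + 1)) with hr
  obtain ⟨m, hm⟩ := hind r (sub_lt_self _ (by positivity))
  set z : ℕ → X := fun i => ∑ j ∈ Finset.range (s+1), (x (e (i+m) j) - x (e (i+m) (s+1))) with hz
  have hzC : ∀ i, ‖z i‖ ≤ (s+1) * (C + C) := by
    intro i
    refine (norm_sum_le_of_le _ (fun j _ => (norm_sub_le _ _).trans
      (add_le_add (hC _) (hC _)))).trans ?_
    simp [mul_add]
  have hbz : ∀ (b : X →L[ℝ] ℝ) i, b (z i) = ∑ j ∈ Finset.range (s+1),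
      (b (x (e (i+m) j)) - b (x (e (i+m) (s+1)))) := fun b i => by simp [hz, map_sum]
  have hθ : ∀ g ∈ convexHull ℝ (Set.range z), ∃ b : B, (s+1) * r ≤ b.1 g := by
    intro g hg
    rw [convexHull_eq_union_convexHull_finite_subsets] at hg
    simp only [Set.mem_iUnion] at hg
    obtain ⟨t, ht, hgt⟩ := hg
    rw [← Set.image_univ] at ht
    classical
    obtain ⟨I, -, rfl⟩ := Finset.subset_set_image_iff.1 ht
    have hdisj : Disjoint ((I ×ˢ Finset.range (s+1)).image (fun p => e (p.1 + m) p.2))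
        (I.image (fun i => e (i + m) (s+1))) := by
      rw [Finset.disjoint_left]
      intro a ha ha'
      obtain ⟨⟨i, j⟩, hij, rfl⟩ := Finset.mem_image.1 ha
      obtain ⟨i', -, h⟩ := Finset.mem_image.1 ha'
      have h3 := (heinj _ _ _ _ h).2
      have h4 := Finset.mem_range.1 (Finset.mem_product.1 hij).2
      simp only at h3 h4
      omega
    obtain ⟨b, hb, c, h1, h2⟩ := hm _ _ hdisj
      (by
        intro a ha
        obtain ⟨⟨i, j⟩, -, rfl⟩ := Finset.mem_image.1 ha
        exact (Nat.le_add_left m i).trans (hele _ _))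
      (by
        intro a ha
        obtain ⟨i, -, rfl⟩ := Finset.mem_image.1 ha
        exact (Nat.le_add_left m i).trans (hele _ _))
    refine ⟨⟨b, hb⟩, ?_⟩
    have hsub : convexHull ℝ (↑(I.image z) : Set X) ⊆ {g | (s+1) * r ≤ b g} := by
      refine convexHull_min ?_ (convex_halfSpace_ge b.isLinear _)
      intro v hv
      obtain ⟨i, hi, rfl⟩ := Finset.mem_image.1 (Finset.mem_coe.1 hv)
      rw [Set.mem_ofPred_eq, hbz]
      have : ∀ j ∈ Finset.range (s+1), r ≤ b (x (e (i+m) j)) - b (x (e (i+m) (s+1))) := by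
        intro j hj
        have h3 := h1 _ (Finset.mem_image_of_mem _ (Finset.mk_mem_product hi hj))
        have h4 := h2 _ (Finset.mem_image_of_mem _ hi)
        simp only at h3 h4
        linarith
      have h5 := Finset.card_nsmul_le_sum _ _ _ this
      simpa using h5
    exact hsub hgt
  obtain ⟨⟨b, hb⟩, hfreq⟩ := exists_frequently_lt_of_attaining (fun b : B => b.1) (M := 1)
    (fun b => by simpa using hB b.2) (exists_forall_apply_le hB hbd) z hzC hθ
    (show (s+1) * r - ε / 2 < (s+1) * r by linarith)
  obtain ⟨ψ, hψ, hψz⟩ := extraction_of_frequently_atTop hfreq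
  have hcomp : IsCompact (Set.univ.pi fun _ : ℕ => Set.Icc (-C) C) :=
    isCompact_univ_pi fun _ => isCompact_Icc
  obtain ⟨l, -, χ, hχ, hl⟩ := hcomp.tendsto_subseq
    (x := fun i j => b (x (e (ψ i + m) j))) (fun i j _ =>
      abs_le.1 ((abs_apply_le_norm hB hb _).trans (hC _)))
  rw [tendsto_pi_nhds] at hl
  have hinj : ∀ j, Function.Injective (fun i => e (ψ (χ i) + m) j) := by
    intro j i i' h
    have := (heinj _ _ _ _ h).1
    exact hχ.injective (hψ.injective (by omega))
  have hconv : ∀ j, Tendsto (fun n => b (x n))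
      (atTop ⊓ 𝓟 (Set.range fun i => e (ψ (χ i) + m) j)) (𝓝 (l j)) := fun j =>
    tendsto_atTop_inf_principal_range (hinj j) (hl j)
  refine ⟨b, hb, l, fun j => Set.range fun i => e (ψ (χ i) + m) j, fun j => ?_, fun j =>
    Set.infinite_range_of_injective (hinj j), hconv, fun j₀ hj₀ => ?_⟩
  · rintro _ ⟨i, rfl⟩
    exact heA _ _
  · have hsum : (s+1) * r - ε / 2 ≤ ∑ j ∈ Finset.range (s+1), (l j - l (s+1)) := by
      refine ge_of_tendsto' (tendsto_finsetSum _ fun j _ => (hl j).sub (hl (s+1))) fun i => ?_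
      have := (hψz (χ i)).le
      rw [hbz] at this
      exact this
    have hle : ∀ j, l j - l (s+1) ≤ δ := fun j => by
      have := neBot_atTop_inf_principal (Set.infinite_range_of_injective (hinj j))
      have := neBot_atTop_inf_principal (Set.infinite_range_of_injective (hinj (s+1)))
      exact sub_le_of_tendsto_of_not_oscillating (hosc b hb) inf_le_left inf_le_left (hconv j)
        (hconv (s+1))
    have hmem : j₀ ∈ Finset.range (s+1) := Finset.mem_range.2 (by omega)
    rw [← Finset.add_sum_erase _ _ hmem] at hsum
    have h1 := Finset.sum_le_card_nsmul ((Finset.range (s+1)).erase j₀)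
      (fun j => l j - l (s+1)) δ (fun j _ => hle j)
    rw [Finset.card_erase_of_mem hmem, Finset.card_range, Nat.add_sub_cancel, nsmul_eq_mul] at h1
    have h2 : (s+1) * r = (s+1) * δ - ε / 2 := by rw [hr]; field_simp
    linarith

end

section

variable {X : Type*} [NormedAddCommGroup X] [NormedSpace ℝ X] {B : Set (X →L[ℝ] ℝ)} {x : ℕ → X}

theorem exists_seq_functional_separating_limits [CompleteSpace X] (hB : B ⊆ closedBall 0 1)
    (hbd : ∀ v : X, ∃ b ∈ B, b v = ‖v‖) {C : ℝ} (hC : ∀ n, ‖x n‖ ≤ C) {δ : ℝ}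
    (hind : ∀ r < δ, ∃ m, ∀ F G : Finset ℕ, Disjoint F G → (∀ i ∈ F, m ≤ i) → (∀ i ∈ G, m ≤ i) →
        ∃ b ∈ B, ∃ c : ℝ, (∀ i ∈ F, c + r < b (x i)) ∧ ∀ i ∈ G, b (x i) < c)
    (hosc : ∀ b ∈ B, ∀ q > δ, ∀ c : ℝ, {n | c + q < b (x n)}.Infinite →
        ¬ {n | b (x n) < c}.Infinite) :
    ∃ (b : ℕ → X →L[ℝ] ℝ) (l : ℕ → ℕ → ℝ) (P : ℕ → Set ℕ), (∀ s, b s ∈ B) ∧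
      (∀ j, (P j).Infinite) ∧
      (∀ s j, Tendsto (fun n => b s (x n)) (atTop ⊓ 𝓟 (P j)) (𝓝 (l s (min j (s + 1))))) ∧
      ∀ s : ℕ, ∀ j ≤ s, δ - 1 / ((s:ℝ) + 1) ≤ l s j - l s (s + 1) := by
  have hstage := fun (A : {A : ℕ → Set ℕ // ∀ j, (A j).Infinite}) (s : ℕ) =>
    exists_functional_separating_limits hB hbd hC hind hosc A.2 s
      (show (0:ℝ) < 1 / ((s:ℝ) + 1) from Nat.one_div_pos_of_nat)
  choose b hbB l A' hsub hinf hlim hsep using hstage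
  set st : ℕ → {A : ℕ → Set ℕ // ∀ j, (A j).Infinite} := fun n =>
    Nat.rec ⟨fun _ => Set.univ, fun _ => Set.infinite_univ⟩
      (fun s A => ⟨fun j => A' A s (min j (s + 1)), fun j => hinf A s _⟩) n with hst
  have hsucc : ∀ s j, (st (s + 1)).1 j = A' (st s) s (min j (s + 1)) := fun s j => rfl
  have hconst : ∀ s j, s ≤ j → (st s).1 j = (st s).1 s := by
    rintro (_ | s) j hj
    · rfl
    · rw [hsucc, hsucc, min_eq_right hj, min_self]
  have hanti : ∀ j, Antitone (fun s => (st s).1 j) := fun j => antitone_nat_of_succ_le fun s => by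
    rw [hsucc]
    refine (hsub (st s) s _).trans ?_
    rcases le_total j (s + 1) with h | h
    · rw [min_eq_left h]
    · rw [min_eq_right h, hconst s (s + 1) (by omega), hconst s j (by omega)]
  have hP := fun j => exists_infinite_almost_subset (hanti j) (fun s => (st s).2 j)
  choose P _ hPinf hPfin using hP
  refine ⟨fun s => b (st s) s, fun s => l (st s) s, P, fun s => hbB _ _, hPinf, fun s j => ?_,
    fun s => hsep _ _⟩
  refine (hlim (st s) s (min j (s + 1))).mono_left ?_
  rw [← hsucc]
  exact atTop_inf_principal_mono (hPfin j (s + 1))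

theorem false_of_weights {δ : ℝ} {B : Set (X →L[ℝ] ℝ)} (hB : B ⊆ closedBall 0 1)
    (hbd : ∀ v : X, ∃ b ∈ B, b v = ‖v‖) [CompleteSpace X] {v : ℕ → X}
    (hv : ∀ b ∈ B, ∀ j, b (v j) ≤ δ) (hlim : ∀ b ∈ B, ∃ j, b (v j) < δ)
    (b : ℕ → X →L[ℝ] ℝ) (hb : ∀ s, b s ∈ B) (hb0 : ∀ s j, s < j → b s (v j) = 0)
    (hbs : ∀ s j : ℕ, j ≤ s → δ - 1 / ((s:ℝ) + 1) ≤ b s (v j)) : False := by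
  have hvn : ∀ j, ‖v j‖ ≤ δ := fun j => by
    obtain ⟨b, hb, h⟩ := hbd (v j)
    exact h ▸ hv b hb j
  have hsδ : Summable (fun j : ℕ => (1/2:ℝ)^(j+1) * δ) :=
    (((summable_nat_add_iff 1).2 summable_geometric_two)).mul_right δ
  have htδ : ∑' j : ℕ, (1/2:ℝ)^(j+1) * δ = δ := by
    rw [tsum_mul_right]
    have : ∑' j : ℕ, (1/2:ℝ)^(j+1) = 1 := by
      simp_rw [pow_succ]
      rw [tsum_mul_right, tsum_geometric_two]; norm_num
    rw [this, one_mul]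
  have hsum : Summable (fun j => (1/2:ℝ)^(j+1) • v j) := by
    refine Summable.of_norm_bounded hsδ fun j => ?_
    rw [norm_smul, Real.norm_of_nonneg (by positivity)]
    exact mul_le_mul_of_nonneg_left (hvn j) (by positivity)
  have happ : ∀ f : X →L[ℝ] ℝ, HasSum (fun j => (1/2:ℝ)^(j+1) * f (v j))
      (f (∑' j, (1/2:ℝ)^(j+1) • v j)) := fun f => by
    simpa using f.hasSum hsum.hasSum
  set w := ∑' j, (1/2:ℝ)^(j+1) • v j with hw
  have hgeo : ∀ n : ℕ, ∑ j ∈ Finset.range n, (1/2:ℝ)^(j+1) = 1 - (1/2:ℝ)^n := by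
    intro n
    induction n with
    | zero => simp
    | succ n ih => rw [Finset.sum_range_succ, ih, pow_succ]; ring
  have hlow : ∀ s : ℕ, (1 - (1/2:ℝ)^(s+1)) * (δ - 1 / ((s:ℝ) + 1)) ≤ ‖w‖ := by
    intro s
    have h1 : b s w = ∑ j ∈ Finset.range (s+1), (1/2:ℝ)^(j+1) * b s (v j) := by
      refine (happ (b s)).unique (hasSum_sum_of_ne_finset_zero fun j hj => ?_)
      rw [hb0 s j (by simpa using hj), mul_zero]
    refine le_trans ?_ (le_of_abs_le (abs_apply_le_norm hB (hb s) w))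
    rw [h1, ← hgeo, Finset.sum_mul]
    exact Finset.sum_le_sum fun j hj =>
      mul_le_mul_of_nonneg_left (hbs s j (by simpa [Nat.lt_succ_iff] using hj)) (by positivity)
  have hwδ : δ ≤ ‖w‖ := by
    refine le_of_tendsto' (f := fun s : ℕ => (1 - (1/2:ℝ)^(s+1)) * (δ - 1 / ((s:ℝ) + 1)))
      (x := atTop) ?_ hlow
    have h1 : Tendsto (fun s : ℕ => (1/2:ℝ)^(s+1)) atTop (𝓝 0) :=
      (tendsto_pow_atTop_nhds_zero_of_lt_one (by norm_num) (by norm_num)).comp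
        (tendsto_add_atTop_nat 1)
    simpa using (h1.const_sub 1).mul (tendsto_one_div_add_atTop_nhds_zero_nat.const_sub δ)
  obtain ⟨f, hf, hfw⟩ := hbd w
  obtain ⟨j, hj⟩ := hlim f hf
  have h1 := Summable.tsum_lt_tsum (i := j) (f := fun j => (1/2:ℝ)^(j+1) * f (v j))
    (g := fun j => (1/2:ℝ)^(j+1) * δ)
    (fun i => mul_le_mul_of_nonneg_left (hv f hf i) (by positivity))
    (mul_lt_mul_of_pos_left hj (by positivity)) (happ f).summable hsδ
  rw [(happ f).tsum_eq, htδ, hfw] at h1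
  exact absurd hwδ (not_le.2 h1)

theorem exists_infinite_not_oscillates [CompleteSpace X] (hB : B ⊆ closedBall 0 1)
    (hbd : ∀ v : X, ∃ b ∈ B, b v = ‖v‖) {K : Set X} {C : ℝ} (hC : ∀ y ∈ K, ‖y‖ ≤ C)
    (hK : ∀ (𝒰 : Ultrafilter ℕ) (y : ℕ → X), (∀ n, y n ∈ K) →
      ∃ z ∈ K, ∀ b ∈ B, Tendsto (fun n => b (y n)) 𝒰 (𝓝 (b z)))
    (hx : ∀ n, x n ∈ K) :
    ∃ N : Set ℕ, N.Infinite ∧ ∀ q > 0, ¬ Oscillates B x ∅ ∅ q N := by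
  by_contra! hcon
  obtain ⟨φ, -, δ, hδ, hind, hosc⟩ := exists_strictMono_independent hB (fun n => hC _ (hx n)) hcon
  have hosc' := fun b hb q hq c => hosc q hq b hb c
  obtain ⟨b, l, P, hbB, hPinf, hlim, hsep⟩ := exists_seq_functional_separating_limits
    (x := fun n => x (φ n)) hB hbd (fun n => hC _ (hx _)) hind hosc'
  have := fun j => neBot_atTop_inf_principal (hPinf j)
  have hle : ∀ j, (Ultrafilter.of (atTop ⊓ 𝓟 (P j)) : Filter ℕ) ≤ atTop ⊓ 𝓟 (P j) := fun j =>
    Ultrafilter.of_le _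
  have hy := fun j => hK (Ultrafilter.of (atTop ⊓ 𝓟 (P j))) (fun n => x (φ n)) (fun n => hx _)
  choose y hyK hy using hy
  obtain ⟨w, -, hw⟩ := hK (hyperfilter ℕ) y hyK
  have hby : ∀ s j, b s (y j) = l s (min j (s + 1)) := fun s j =>
    tendsto_nhds_unique (hy j _ (hbB s)) ((hlim s j).mono_left (hle j))
  have hyper : (hyperfilter ℕ : Filter ℕ) ≤ atTop := Nat.hyperfilter_le_atTop
  have hbw : ∀ s, b s w = l s (s + 1) := by
    intro s
    refine tendsto_nhds_unique (hw _ (hbB s)) (tendsto_const_nhds.congr' ?_)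
    filter_upwards [hyper (eventually_gt_atTop s)] with j hj
    rw [hby, min_eq_right (Nat.succ_le_of_lt hj)]
  have hyy : ∀ f ∈ B, ∀ i j, f (y j) - f (y i) ≤ δ := fun f hf i j =>
    sub_le_of_tendsto_of_not_oscillating (x := fun n => x (φ n)) (hosc' f hf)
      ((hle j).trans inf_le_left) ((hle i).trans inf_le_left) (hy j f hf) (hy i f hf)
  refine false_of_weights (δ := δ) hB hbd (v := fun j => y j - w) (fun f hf j => ?_) (fun f hf => ?_) b
    hbB (fun s j hj => ?_) (fun s j hj => ?_)
  · rw [map_sub]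
    exact le_of_tendsto' ((hw f hf).const_sub _) fun i => hyy f hf i j
  · have h1 : Tendsto (fun j => f (y j - w)) (hyperfilter ℕ) (𝓝 0) := by
      simpa using (hw f hf).sub_const (f w)
    exact (h1.eventually_lt_const hδ).exists
  · rw [map_sub, hby, hbw, min_eq_right (Nat.succ_le_of_lt hj), sub_self]
  · rw [map_sub, hby, hbw, min_eq_left (by omega)]
    exact hsep s j hj

end

section

variable {X : Type*} [NormedAddCommGroup X] [NormedSpace ℝ X] {B : Set (X →L[ℝ] ℝ)} {x : ℕ → X}

theorem exists_subseq_tendsto_weak [CompleteSpace X] (hB : B ⊆ closedBall 0 1)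
    (hbd : ∀ v : X, ∃ b ∈ B, b v = ‖v‖) {K : Set X} {C : ℝ} (hC : ∀ y ∈ K, ‖y‖ ≤ C)
    (hK : ∀ (𝒰 : Ultrafilter ℕ) (y : ℕ → X), (∀ n, y n ∈ K) →
      ∃ z ∈ K, ∀ b ∈ B, Tendsto (fun n => b (y n)) 𝒰 (𝓝 (b z)))
    (hx : ∀ n, x n ∈ K) :
    ∃ φ : ℕ → ℕ, StrictMono φ ∧ ∃ z : X, ∀ f : X →L[ℝ] ℝ,
      Tendsto (fun n => f (x (φ n))) atTop (𝓝 (f z)) := by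
  obtain ⟨N, hN, hosc⟩ := exists_infinite_not_oscillates hB hbd hC hK hx
  obtain ⟨φ, hφ, hφN⟩ := extraction_of_frequently_atTop (Nat.frequently_atTop_iff_infinite.2 hN)
  obtain ⟨z, hzK, hz⟩ := hK (hyperfilter ℕ) (fun n => x (φ n)) (fun n => hx _)
  have hinf : ∀ P : ℕ → Prop, (∃ᶠ n in atTop, P (φ n)) → {n ∈ N | P n}.Infinite := by
    intro P hP
    refine ((Nat.frequently_atTop_iff_infinite.1 hP).image hφ.injective.injOn).mono ?_
    rintro _ ⟨n, hn, rfl⟩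
    exact ⟨hφN n, hn⟩
  have hhyp : ∀ P : ℕ → Prop, (∀ᶠ n in (hyperfilter ℕ : Filter ℕ), P n) → ∃ᶠ n in atTop, P n :=
    fun P hP => hP.frequently.filter_mono Nat.hyperfilter_le_atTop
  have hBlim : ∀ b ∈ B, Tendsto (fun n => b (x (φ n))) atTop (𝓝 (b z)) := by
    intro b hb
    refine tendsto_order.2 ⟨fun a ha => ?_, fun a ha => ?_⟩
    · by_contra hcon
      obtain ⟨c, hac, hcz⟩ := exists_between ha
      obtain ⟨d, hcd, hdz⟩ := exists_between hcz
      refine hosc (d - c) (by linarith) ⟨b, hb, c, by simp, by simp, hinf _ (hhyp _ ?_),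
        hinf (fun n => b (x n) < c) ?_⟩
      · exact (hz b hb).eventually_const_lt (by linarith)
      · exact (not_eventually.1 hcon).mono fun n hn => (not_lt.1 hn).trans_lt hac
    · by_contra hcon
      obtain ⟨d, hzd, hda⟩ := exists_between ha
      obtain ⟨c, hzc, hcd⟩ := exists_between hzd
      refine hosc (d - c) (by linarith) ⟨b, hb, c, by simp, by simp,
        hinf (fun n => c + (d - c) < b (x n)) ?_, hinf _ (hhyp _ ?_)⟩
      · refine (not_eventually.1 hcon).mono fun n hn => ?_
        have := not_lt.1 hn
        linarith
      · exact (hz b hb).eventually_lt_const hzc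
  have hupper : ∀ (f : X →L[ℝ] ℝ), ∀ ε > 0, ∀ᶠ n in atTop, f (x (φ n) - z) < ε := by
    intro f ε hε
    by_contra hcon
    obtain ⟨ψ, hψ, hψf⟩ := extraction_of_frequently_atTop (not_eventually.1 hcon)
    have hpos : (0:ℝ) < ‖f‖ + 1 := by positivity
    have hθ : ∀ g ∈ convexHull ℝ (Set.range fun n => x (φ (ψ n)) - z),
        ∃ b : B, ε / (‖f‖ + 1) ≤ b.1 g := by
      intro g hg
      have hsub : convexHull ℝ (Set.range fun n => x (φ (ψ n)) - z) ⊆ {g | ε ≤ f g} := by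
        refine convexHull_min ?_ (convex_halfSpace_ge f.isLinear _)
        rintro _ ⟨n, rfl⟩
        exact not_lt.1 (hψf n)
      obtain ⟨b, hb, hbg⟩ := hbd g
      refine ⟨⟨b, hb⟩, ?_⟩
      rw [div_le_iff₀ hpos]
      simp only [hbg]
      have h1 : ε ≤ f g := hsub hg
      have h2 := (le_abs_self _).trans (f.le_opNorm g)
      nlinarith [norm_nonneg g]
    obtain ⟨⟨b, hb⟩, hfreq⟩ := exists_frequently_lt_of_attaining (fun b : B => b.1) (M := 1)
      (fun b => by simpa using hB b.2) (exists_forall_apply_le hB hbd)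
      (fun n => x (φ (ψ n)) - z) (C := C + C)
      (fun n => (norm_sub_le _ _).trans (add_le_add (hC _ (hx _)) (hC _ hzK))) hθ
      (half_lt_self (show (0:ℝ) < ε / (‖f‖ + 1) by positivity))
    have h1 : Tendsto (fun n => b (x (φ (ψ n)) - z)) atTop (𝓝 0) := by
      simpa using ((hBlim b hb).comp hψ.tendsto_atTop).sub_const (b z)
    have h2 := h1.eventually_lt_const (show 0 < ε / (‖f‖ + 1) / 2 by positivity)
    exact hfreq (h2.mono fun n hn => not_lt.2 hn.le)
  refine ⟨φ, hφ, z, fun f => tendsto_order.2 ⟨fun a ha => ?_, fun a ha => ?_⟩⟩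
  · filter_upwards [hupper (-f) (f z - a) (by linarith)] with n hn
    rw [neg_apply, map_sub] at hn
    linarith
  · filter_upwards [hupper f (a - f z) (by linarith)] with n hn
    rw [map_sub] at hn
    linarith

theorem mem_closure_span_of_tendsto_weak {σ : ℕ → ℕ} {z : X}
    (h : ∀ f : X →L[ℝ] ℝ, Tendsto (fun n => f (x (σ n))) atTop (𝓝 (f z))) :
    z ∈ closure (Submodule.span ℝ (Set.range x) : Set X) := by
  by_contra hz
  set p := Submodule.span ℝ (Set.range x) with hp
  have hconv : Convex ℝ (closure (p : Set X)) := p.convex.closure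
  obtain ⟨f, u, hfu, huz⟩ := geometric_hahn_banach_closed_point hconv isClosed_closure hz
  have hu : 0 < u := by simpa using hfu 0 (subset_closure p.zero_mem)
  have h0 : ∀ v ∈ p, f v = 0 := by
    intro v hv
    by_contra hne
    have := hfu ((u / f v) • v) (subset_closure (p.smul_mem _ hv))
    rw [map_smul, smul_eq_mul, div_mul_cancel₀ _ hne] at this
    exact lt_irrefl _ this
  have h1 : f z = 0 := by
    refine tendsto_nhds_unique (h f) (tendsto_const_nhds.congr fun n => ?_)
    exact (h0 _ (Submodule.subset_span ⟨_, rfl⟩)).symm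
  linarith

/-- The points of the closed span of `x` at which each functional is at most its
supremum in absolute value along `x`. -/
def spanHull (x : ℕ → X) : Set X :=
  {z | z ∈ closure (Submodule.span ℝ (Set.range x) : Set X) ∧
    ∀ (h : X →L[ℝ] ℝ) (c : ℝ), (∀ k, |h (x k)| ≤ c) → h z ≤ c}

theorem neg_mem_spanHull {z : X} (hz : z ∈ spanHull x) : -z ∈ spanHull x := by
  refine ⟨?_, fun h c hc => ?_⟩
  · exact (Submodule.span ℝ (Set.range x)).topologicalClosure.neg_mem hz.1
  · have := hz.2 (-h) c (by simpa using hc)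
    simpa using this

theorem exists_mem_spanHull_forall_abs_le {C : ℝ} (hC : ∀ n, ‖x n‖ ≤ C)
    (hseq : ∀ σ : ℕ → ℕ, ∃ φ : ℕ → ℕ, StrictMono φ ∧ ∃ z : X, ∀ f : X →L[ℝ] ℝ,
      Tendsto (fun n => f (x (σ (φ n)))) atTop (𝓝 (f z))) (h : X →L[ℝ] ℝ) :
    ∃ z ∈ spanHull x, ∀ k, |h (x k)| ≤ h z := by
  have hbdd : BddAbove (Set.range fun k => |h (x k)|) := by
    refine ⟨‖h‖ * C, ?_⟩
    rintro _ ⟨k, rfl⟩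
    exact (h.le_opNorm _).trans (mul_le_mul_of_nonneg_left (hC k) (norm_nonneg _))
  obtain ⟨v, -, hv, hvm⟩ := exists_seq_tendsto_sSup (Set.range_nonempty _) hbdd
  choose σ hσ using hvm
  obtain ⟨φ, hφ, z, hz⟩ := hseq σ
  have habs : |h z| = sSup (Set.range fun k => |h (x k)|) := by
    refine tendsto_nhds_unique (hz h).abs ((hv.comp hφ.tendsto_atTop).congr fun n => ?_)
    exact (hσ _).symm
  have hzT : z ∈ spanHull x := ⟨mem_closure_span_of_tendsto_weak (σ := fun n => σ (φ n)) hz,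
    fun g c hc => le_of_tendsto' (hz g) fun n => (le_abs_self _).trans (hc _)⟩
  have hle : ∀ k, |h (x k)| ≤ |h z| := fun k => habs ▸ le_csSup hbdd ⟨k, rfl⟩
  rcases le_total 0 (h z) with h0 | h0
  · exact ⟨z, hzT, fun k => (hle k).trans_eq (abs_of_nonneg h0)⟩
  · exact ⟨-z, neg_mem_spanHull hzT, fun k => (hle k).trans_eq (by rw [abs_of_nonpos h0, map_neg])⟩

theorem apply_le_of_forall_abs_le {S : lp (fun _ : ℕ => ℝ) 1 →L[ℝ] X}
    (hS : ∀ j : ℕ, S (lp.single 1 j (1 : ℝ)) = x j) {h : X →L[ℝ] ℝ} {c : ℝ}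
    (hc : ∀ k, |h (x k)| ≤ c) {a : lp (fun _ : ℕ => ℝ) 1} (ha : ‖a‖ ≤ 1) : h (S a) ≤ c := by
  have hc0 : 0 ≤ c := (abs_nonneg _).trans (hc 0)
  have h1 : HasSum (fun i => a i * h (x i)) (h (S a)) := by
    have h3 : ∀ i, h (S (lp.single 1 i (a i))) = a i * h (x i) := fun i => by
      rw [← hS i, ← smul_eq_mul, ← map_smul, ← map_smul, ← lp.single_smul, smul_eq_mul, mul_one]
    simpa [h3] using (h.comp S).hasSum (lp.hasSum_single (by norm_num) a)
  have h2 : HasSum (fun i => |a i|) ‖a‖ := by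
    simpa using lp.hasSum_norm (p := 1) (by norm_num) a
  calc h (S a) ≤ ‖a‖ * c := hasSum_le (fun i => by
        refine (le_abs_self _).trans ?_
        rw [abs_mul]
        exact mul_le_mul_of_nonneg_left (hc i) (abs_nonneg _)) h1 (h2.mul_right c)
    _ ≤ c := mul_le_of_le_one_left hc0 ha

end

section

variable {X : Type*} [NormedAddCommGroup X] [NormedSpace ℝ X] {x : ℕ → X}

theorem exists_extension_norm_le_of_le {E : Type*} [NormedAddCommGroup E] [NormedSpace ℝ E]
    {θ : ℝ} (hθ : 0 ≤ θ) (G : StrongDual ℝ E) (p : Submodule ℝ E)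
    (hG : ∀ f ∈ p, G f ≤ θ * ‖f‖) :
    ∃ g : StrongDual ℝ E, (∀ f ∈ p, g f = G f) ∧ ‖g‖ ≤ θ := by
  obtain ⟨g, hg, hgn⟩ := exists_extension_norm_eq p (G.comp p.subtypeL)
  refine ⟨g, fun f hf => hg ⟨f, hf⟩, hgn.le.trans ?_⟩
  refine ContinuousLinearMap.opNorm_le_bound _ hθ fun f => ?_
  have h1 := hG f f.2
  have h2 := hG (-f) (p.neg_mem f.2)
  rw [map_neg, norm_neg] at h2
  rw [Real.norm_eq_abs, abs_le]
  change -(θ * ‖(f : E)‖) ≤ G f ∧ G f ≤ θ * ‖(f : E)‖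
  exact ⟨by linarith, h1⟩

theorem Isometry.exists_pos_forall_le_norm_sub {E F : Type*} [NormedAddCommGroup E]
    [CompleteSpace E] [NormedAddCommGroup F] {J : E → F} (hJ : Isometry J) {G : F}
    (hG : ∀ v, J v ≠ G) : ∃ r > 0, ∀ v, r ≤ ‖G - J v‖ := by
  have hclosed : IsClosed (Set.range J) := hJ.isClosedEmbedding.isClosed_range
  obtain ⟨r, hr, hball⟩ := Metric.isOpen_iff.1 hclosed.isOpen_compl G
    (by rintro ⟨v, hv⟩; exact hG v hv)
  refine ⟨r, hr, fun v => ?_⟩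
  by_contra! hlt
  have hmem : J v ∈ ball G r := by rwa [mem_ball, dist_comm, dist_eq_norm]
  exact hball hmem ⟨v, rfl⟩

theorem exists_annihilating_of_lt_dist {E : Type*} [NormedAddCommGroup E] [NormedSpace ℝ E]
    {G : StrongDual ℝ E} {θ : ℝ} (hθ : 0 ≤ θ) {n : ℕ} (u : Fin n → StrongDual ℝ E)
    (hG : ∀ c : Fin n → ℝ, θ < ‖G - ∑ k, c k • u k‖) :
    ∃ f : E, ‖f‖ ≤ 1 ∧ (∀ k, u k f = 0) ∧ θ ≤ G f := by
  by_contra! hcon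
  let L : Fin n → E →ₗ[ℝ] ℝ := fun k => (u k).toLinearMap
  let p : Submodule ℝ E := ⨅ k, LinearMap.ker (L k)
  have hmem : ∀ f : E, f ∈ p ↔ ∀ k, u k f = 0 := by
    intro f
    simp only [p, Submodule.mem_iInf, LinearMap.mem_ker]
    exact Iff.rfl
  have hle : ∀ f ∈ p, G f ≤ θ * ‖f‖ := by
    intro f hf
    rcases (norm_nonneg f).eq_or_lt with h0 | h0
    · have : f = 0 := norm_eq_zero.1 h0.symm
      simp [this]
    · have h1 := hcon (‖f‖⁻¹ • f) (by rw [norm_smul, norm_inv, norm_norm, inv_mul_cancel₀ h0.ne'])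
        ((hmem _).1 (p.smul_mem _ hf))
      rw [map_smul, smul_eq_mul, inv_mul_lt_iff₀ h0] at h1
      linarith
  obtain ⟨g, hg, hgn⟩ := exists_extension_norm_le_of_le hθ G p hle
  have hspan : (G - g).toLinearMap ∈ Submodule.span ℝ (Set.range L) := by
    refine mem_span_of_iInf_ker_le_ker fun f hf => ?_
    rw [LinearMap.mem_ker]
    change G f - g f = 0
    rw [sub_eq_zero, hg f hf]
  obtain ⟨c, hc⟩ := (Submodule.mem_span_range_iff_exists_fun ℝ).1 hspan
  refine (hG c).not_ge ?_
  have h1 : G - ∑ k, c k • u k = g := by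
    ext f
    have := LinearMap.congr_fun hc f
    simp only [LinearMap.sum_apply, LinearMap.smul_apply] at this
    change _ = G f - g f at this
    rw [sub_apply, sum_apply]
    change G f - ∑ k, c k • L k f = g f
    linarith
  rwa [h1]

theorem mem_range_inclusionInDoubleDual [CompleteSpace X] {C : ℝ} (hC : ∀ n, ‖x n‖ ≤ C)
    (hseq : ∀ σ : ℕ → ℕ, ∃ φ : ℕ → ℕ, StrictMono φ ∧ ∃ z : X, ∀ f : X →L[ℝ] ℝ,
      Tendsto (fun n => f (x (σ (φ n)))) atTop (𝓝 (f z)))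
    {G : StrongDual ℝ (StrongDual ℝ X)}
    (hG : ∀ (f : StrongDual ℝ X) (c : ℝ), (∀ k, |f (x k)| ≤ c) → G f ≤ c) :
    G ∈ Set.range (NormedSpace.inclusionInDoubleDual ℝ X) := by
  by_contra hnot
  set J := NormedSpace.inclusionInDoubleDual ℝ X with hJ
  obtain ⟨r, hr, hrJ⟩ :=
    (NormedSpace.inclusionInDoubleDualLi ℝ (E := X)).isometry.exists_pos_forall_le_norm_sub (G := G)
    (fun v hv => hnot ⟨v, hv⟩)
  have hdist : ∀ v, r / 2 < ‖G - J v‖ := fun v => (half_lt_self hr).trans_le (hrJ v)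
  have hex : ∀ n : ℕ, ∃ f : StrongDual ℝ X, ‖f‖ ≤ 1 ∧ (∀ k < n, f (x k) = 0) ∧ r / 2 ≤ G f := by
    intro n
    obtain ⟨f, hf1, hf0, hfG⟩ := exists_annihilating_of_lt_dist (half_pos hr).le
      (fun k : Fin n => J (x k)) (fun c => by simpa using hdist (∑ k, c k • x k))
    exact ⟨f, hf1, fun k hk => hf0 ⟨k, hk⟩, hfG⟩
  choose f hf1 hf0 hfG using hex
  have hsup := exists_mem_spanHull_forall_abs_le hC hseq
  have hTC : ∀ z : spanHull x, ‖J z‖ ≤ C := by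
    intro z
    have hC0 : 0 ≤ C := (norm_nonneg _).trans (hC 0)
    refine ContinuousLinearMap.opNorm_le_bound _ hC0 fun h => ?_
    have hb : ∀ h : StrongDual ℝ X, h z ≤ C * ‖h‖ := fun h => z.2.2 h _ fun k => by
      rw [mul_comm]
      exact (h.le_opNorm _).trans (mul_le_mul_of_nonneg_left (hC k) (norm_nonneg _))
    have h1 := hb h
    have h2 := hb (-h)
    rw [neg_apply, norm_neg] at h2
    rw [NormedSpace.dual_def, Real.norm_eq_abs, abs_le]
    exact ⟨by linarith, h1⟩
  obtain ⟨z, hz⟩ := exists_frequently_lt_of_attaining (fun z : spanHull x => J z) hTC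
    (fun h => by
      obtain ⟨z, hz, hmax⟩ := hsup h
      exact ⟨⟨z, hz⟩, fun z' => z'.2.2 h _ hmax⟩) f hf1
    (fun g hg => by
      obtain ⟨z, hz, hmax⟩ := hsup g
      refine ⟨⟨z, hz⟩, le_trans ?_ (hG g _ hmax)⟩
      have hsub : convexHull ℝ (Set.range f) ⊆ {g | r / 2 ≤ G g} := by
        refine convexHull_min ?_ (convex_halfSpace_ge G.isLinear _)
        rintro _ ⟨n, rfl⟩
        exact hfG n
      exact hsub hg)
    (half_lt_self (half_pos hr))
  obtain ⟨v, hv, hzv⟩ := Metric.mem_closure_iff.1 z.2.1 (r / 2 / 2) (half_pos (half_pos hr))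
  have hev : ∀ᶠ n in atTop, f n v = 0 := by
    clear hzv
    induction hv using Submodule.span_induction with
    | mem v hv =>
      obtain ⟨k, rfl⟩ := hv
      filter_upwards [eventually_gt_atTop k] with n hn using hf0 n k hn
    | zero => simp
    | add v w _ _ hv hw => filter_upwards [hv, hw] with n h1 h2 using by simp [h1, h2]
    | smul c v _ hv => filter_upwards [hv] with n h1 using by simp [h1]
  refine hz (hev.mono fun n hn => not_lt.2 ?_)
  have h1 : f n z = f n (z - v) := by rw [map_sub, hn, sub_zero]
  rw [NormedSpace.dual_def, h1]
  have h2 := (f n).le_of_opNorm_le (hf1 n) (z - v)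
  rw [one_mul, ← dist_eq_norm] at h2
  exact (le_of_abs_le h2).trans hzv.le

theorem isCompact_closure_weakTop_image [CompleteSpace X] {C : ℝ} (hC : ∀ n, ‖x n‖ ≤ C)
    (hseq : ∀ σ : ℕ → ℕ, ∃ φ : ℕ → ℕ, StrictMono φ ∧ ∃ z : X, ∀ f : X →L[ℝ] ℝ,
      Tendsto (fun n => f (x (σ (φ n)))) atTop (𝓝 (f z)))
    {A : Set X} {M : ℝ} (hA : ∀ v ∈ A, ‖v‖ ≤ M)
    (hAx : ∀ v ∈ A, ∀ (f : X →L[ℝ] ℝ) (c : ℝ), (∀ k, |f (x k)| ≤ c) → f v ≤ c) :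
    @IsCompact X (weakTop X) (@closure X (weakTop X) A) := by
  let e : X → (X →L[ℝ] ℝ) → ℝ := fun v f => f v
  have hind : @IsInducing X _ (weakTop X) _ e := @IsInducing.mk _ _ (weakTop X) _ _ rfl
  have hQ : ∀ F ∈ closure (e '' A), ∀ P : ((X →L[ℝ] ℝ) → ℝ) → Prop,
      IsClosed {F | P F} → (∀ v ∈ A, P (e v)) → P F := by
    intro F hF P hP hPA
    have : closure (e '' A) ⊆ {F | P F} := closure_minimal (by
      rintro _ ⟨v, hv, rfl⟩
      exact hPA v hv) hP
    exact this hF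
  have habs : ∀ F ∈ closure (e '' A), ∀ f, |F f| ≤ M * ‖f‖ := fun F hF f =>
    hQ F hF (fun F => |F f| ≤ M * ‖f‖) (isClosed_le (continuous_apply f).abs continuous_const)
      fun v hv => by
        rw [mul_comm]
        exact (f.le_opNorm v).trans (mul_le_mul_of_nonneg_left (hA v hv) (norm_nonneg _))
  have hcomp : IsCompact (closure (e '' A)) := by
    refine (isCompact_univ_pi fun f : X →L[ℝ] ℝ =>
      isCompact_Icc (a := -(M * ‖f‖)) (b := M * ‖f‖)).of_isClosed_subset isClosed_closure ?_
    exact fun F hF f _ => abs_le.1 (habs F hF f)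
  rw [@IsInducing.closure_eq_preimage_closure_image _ _ e _ (weakTop X) hind A]
  refine @IsInducing.isCompact_preimage' _ _ (weakTop X) _ e hind _ hcomp fun F hF => ?_
  let G₀ : (StrongDual ℝ X) →ₗ[ℝ] ℝ :=
    { toFun := F
      map_add' := fun f g => hQ F hF (fun F => F (f + g) = F f + F g)
        (isClosed_eq (continuous_apply _) ((continuous_apply f).add (continuous_apply g)))
        fun v _ => rfl
      map_smul' := fun c f => hQ F hF (fun F => F (c • f) = c • F f)
        (isClosed_eq (continuous_apply _) ((continuous_apply f).const_smul c))
        fun v _ => rfl }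
  let G : StrongDual ℝ (StrongDual ℝ X) := G₀.mkContinuous M (habs F hF)
  obtain ⟨v, hv⟩ := mem_range_inclusionInDoubleDual (G := G) hC hseq fun f c hc =>
    hQ F hF (fun F => F f ≤ c) (isClosed_le (continuous_apply f) continuous_const)
      fun v hv => hAx v hv f c hc
  refine ⟨v, ?_⟩
  ext f
  exact congrArg (fun G => G f) hv

theorem exists_tendsto_of_isCompact_ptwTop {B : Set (X →L[ℝ] ℝ)} {K : Set X}
    (hK : @IsCompact X (ptwTop B) K) (𝒰 : Ultrafilter ℕ) {y : ℕ → X} (hy : ∀ n, y n ∈ K) :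
    ∃ z ∈ K, ∀ b ∈ B, Tendsto (fun n => b (y n)) 𝒰 (𝓝 (b z)) := by
  let e : X → B → ℝ := fun v b => b.1 v
  have hind : @IsInducing X _ (ptwTop B) _ e := @IsInducing.mk _ _ (ptwTop B) _ _ rfl
  obtain ⟨z, hz, hle⟩ := (@isCompact_iff_ultrafilter_le_nhds' X (ptwTop B) K).1 hK (𝒰.map y)
    (Ultrafilter.mem_map.2 (Filter.univ_mem' hy))
  refine ⟨z, hz, fun b hb => ?_⟩
  have h1 : Tendsto (fun n => e (y n)) 𝒰 (𝓝 (e z)) :=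
    (@Continuous.tendsto _ _ (ptwTop B) _ e
      (@IsInducing.continuous _ _ e _ (ptwTop B) hind) z).comp hle
  exact tendsto_pi_nhds.1 h1 ⟨b, hb⟩

theorem norm_le_of_mem_closure_ptwTop {B : Set (X →L[ℝ] ℝ)} (hB : B ⊆ closedBall 0 1)
    (hbd : ∀ v : X, ∃ b ∈ B, b v = ‖v‖) {A : Set X} {C : ℝ} (hA : ∀ v ∈ A, ‖v‖ ≤ C) {y : X}
    (hy : y ∈ @closure X (ptwTop B) A) : ‖y‖ ≤ C := by
  let e : X → B → ℝ := fun v b => b.1 v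
  have hind : @IsInducing X _ (ptwTop B) _ e := @IsInducing.mk _ _ (ptwTop B) _ _ rfl
  rw [@IsInducing.closure_eq_preimage_closure_image _ _ e _ (ptwTop B) hind A] at hy
  obtain ⟨b, hb, hby⟩ := hbd y
  have hsub : closure (e '' A) ⊆ {F | F ⟨b, hb⟩ ≤ C} := closure_minimal (by
    rintro _ ⟨v, hv, rfl⟩
    exact (le_of_abs_le (abs_apply_le_norm hB hb v)).trans (hA v hv))
    (isClosed_le (continuous_apply _) continuous_const)
  exact hby ▸ hsub hy

end

/-- if `B` is a boundary for `X` and the bounded sequence `(xₙ)` has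
relatively τ_B-compact range, then the operator `S : ℓ¹ → X`, `S(λ) = Σ λₙ xₙ`
(determined by `S δⱼ = xⱼ`), is weakly compact. -/
theorem stmt9 {X : Type*} [NormedAddCommGroup X] [NormedSpace ℝ X] [CompleteSpace X]
    (B : Set (X →L[ℝ] ℝ)) (hBball : B ⊆ Metric.closedBall 0 1)
    -- `B` is a boundary for `X`:
    (hB : ∀ x : X, ∃ b ∈ B, b x = ‖x‖)
    (x : ℕ → X) (hxbdd : IsBounded (Set.range x))
    -- `A = {xₙ}` is relatively τ_B-compact:
    (hcp : @IsCompact X (ptwTop B) (@closure X (ptwTop B) (Set.range x)))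
    -- `S : ℓ¹ → X` with `S δⱼ = xⱼ`:
    (S : lp (fun _ : ℕ => ℝ) 1 →L[ℝ] X)
    (hS : ∀ j : ℕ, S (lp.single 1 j (1 : ℝ)) = x j) :
    -- `S` is weakly compact:
    @IsCompact X (weakTop X)
      (@closure X (weakTop X) (S '' Metric.closedBall 0 1)) := by
  obtain ⟨C, hC⟩ := hxbdd.exists_norm_le
  have hxC : ∀ n, ‖x n‖ ≤ C := fun n => hC _ ⟨n, rfl⟩
  set K : Set X := @closure X (ptwTop B) (Set.range x) with hK
  have hxK : ∀ n, x n ∈ K := fun n => @subset_closure X (ptwTop B) _ _ ⟨n, rfl⟩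
  have hKC : ∀ y ∈ K, ‖y‖ ≤ C := fun y hy => norm_le_of_mem_closure_ptwTop hBball hB hC hy
  refine isCompact_closure_weakTop_image hxC (fun σ => exists_subseq_tendsto_weak hBball hB hKC
    (fun 𝒰 y hy => exists_tendsto_of_isCompact_ptwTop hcp 𝒰 hy) (fun n => hxK (σ n))) (M := ‖S‖)
    ?_ ?_
  · rintro _ ⟨a, ha, rfl⟩
    exact (S.le_opNorm a).trans (mul_le_of_le_one_right (norm_nonneg _) (by simpa using ha))
  · rintro _ ⟨a, ha, rfl⟩ f c hc
    exact apply_le_of_forall_abs_le hS hc (by simpa using ha)
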